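/- arXiv:1307.2148 — 2 statements merged into one kernel-verified Lean document; each statement's English description precedes it below -/
import Mathlib

section
/- Fix an integer L ≥ 1, real numbers q and J_1,…,J_{L−1}. For the completely asymmetric 1D pair Hamiltonian on the segment, H(σ,τ) = −∑_{i=1}^{L−1} J_i σ_i τ_{i+1} − q ∑_{i=1}^{L} σ_i τ_i, the weak balance condition holds: for every σ ∈ {−1,+1}^{L}, ∑_{τ∈{−1,+1}^{L}} exp(−H(σ,τ)) = ∑_{τ∈{−1,+1}^{L}} exp(−H(τ,σ)). -/
open Finset

/-- The partition function of independent `±1` spins in the fields `h i`. -/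
theorem sum_spin_exp_sum_mul {ι : Type*} [Fintype ι] [DecidableEq ι] (h : ι → ℝ) :
    ∑ τ : ι → ({-1, 1} : Finset ℝ), Real.exp (∑ i, h i * (τ i : ℝ)) =
      ∏ i, (2 * Real.cosh (h i)) := by
  have key (i : ι) : 2 * Real.cosh (h i) =
      ∑ s : ({-1, 1} : Finset ℝ), Real.exp (h i * (s : ℝ)) := by
    rw [Finset.sum_coe_sort ({-1, 1} : Finset ℝ) (fun s => Real.exp (h i * s)),
      Finset.sum_pair (by norm_num), Real.cosh_eq]
    simp only [mul_neg, mul_one]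
    ring
  simp_rw [key, Real.exp_sum]
  exact (Fintype.prod_sum fun i (s : ({-1, 1} : Finset ℝ)) => Real.exp (h i * (s : ℝ))).symm

theorem spin_eq_neg_one_or_eq_one (s : ({-1, 1} : Finset ℝ)) : (s : ℝ) = -1 ∨ (s : ℝ) = 1 := by
  obtain ⟨x, hx⟩ := s
  simpa using hx

theorem cosh_mul_spin (q : ℝ) (s : ({-1, 1} : Finset ℝ)) :
    Real.cosh (q * (s : ℝ)) = Real.cosh q := by
  rcases spin_eq_neg_one_or_eq_one s with h | h <;> simp [h]

theorem cosh_mul_spin_add_mul_spin_comm (a q : ℝ) (s t : ({-1, 1} : Finset ℝ)) :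
    Real.cosh (a * (s : ℝ) + q * (t : ℝ)) = Real.cosh (a * (t : ℝ) + q * (s : ℝ)) := by
  rcases spin_eq_neg_one_or_eq_one s with hs | hs <;>
    rcases spin_eq_neg_one_or_eq_one t with ht | ht <;> rw [hs, ht]
  all_goals
    rw [← Real.cosh_neg]
    congr 1
    ring

/-- **Weak balance for the completely asymmetric 1D Ising PCA on the segment.**
Here the segment has `L = n + 1 ≥ 1` sites (empty boundary conditions) and
`H (σ,τ) = -∑_{i=1}^{L-1} J i * σ i * τ (i+1) - q * ∑_{i=1}^{L} σ i * τ i`.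
Then `∑ τ, exp (-H (σ,τ)) = ∑ τ, exp (-H (τ,σ))` for every `σ`. -/
theorem one_d_segment_weak_balance (n : ℕ) (q : ℝ) (J : Fin n → ℝ)
    (H : (Fin (n + 1) → ({-1, 1} : Finset ℝ)) → (Fin (n + 1) → ({-1, 1} : Finset ℝ)) → ℝ)
    (hH : ∀ σ τ, H σ τ =
      -∑ i : Fin n, J i * (σ i.castSucc : ℝ) * (τ i.succ : ℝ)
        - q * ∑ i : Fin (n + 1), (σ i : ℝ) * (τ i : ℝ)) :
    ∀ σ : Fin (n + 1) → ({-1, 1} : Finset ℝ),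
      ∑ τ : Fin (n + 1) → ({-1, 1} : Finset ℝ), Real.exp (-H σ τ) =
        ∑ τ : Fin (n + 1) → ({-1, 1} : Finset ℝ), Real.exp (-H τ σ) := by
  intro σ
  have forward (τ : Fin (n + 1) → ({-1, 1} : Finset ℝ)) : -H σ τ =
      ∑ i, (Fin.cons (q * (σ 0 : ℝ)) fun i : Fin n =>
        J i * (σ i.castSucc : ℝ) + q * (σ i.succ : ℝ) : Fin (n + 1) → ℝ) i * (τ i : ℝ) := by
    rw [hH, Fin.sum_univ_succ, Fin.sum_univ_succ]
    simp only [Fin.cons_zero, Fin.cons_succ, add_mul, sum_add_distrib, mul_add, mul_sum,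
      mul_assoc]
    ring
  have backward (τ : Fin (n + 1) → ({-1, 1} : Finset ℝ)) : -H τ σ =
      ∑ i, (Fin.snoc (fun i : Fin n =>
        J i * (σ i.succ : ℝ) + q * (σ i.castSucc : ℝ)) (q * (σ (Fin.last n) : ℝ)) :
          Fin (n + 1) → ℝ) i * (τ i : ℝ) := by
    rw [hH, Fin.sum_univ_castSucc, Fin.sum_univ_castSucc]
    simp only [Fin.snoc_last, Fin.snoc_castSucc, add_mul, sum_add_distrib, mul_add, mul_sum,
      mul_assoc, mul_comm (τ _ : ℝ)]
    ring
  simp_rw [forward, backward]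
  rw [sum_spin_exp_sum_mul, sum_spin_exp_sum_mul, Fin.prod_univ_succ, Fin.prod_univ_castSucc]
  simp only [Fin.cons_zero, Fin.cons_succ, Fin.snoc_last, Fin.snoc_castSucc, cosh_mul_spin]
  rw [mul_comm]
  congr 1
  exact prod_congr rfl fun i _ => by rw [cosh_mul_spin_add_mul_spin_comm]
end

section
/- Fix an integer N ≥ 1 and real numbers J and q. For the completely asymmetric 2D pair Hamiltonian on the torus, H(σ,τ) = −J ∑_{(i,j)∈(ℤ/Nℤ)²} ( σ_{i,j} τ_{i,j+1} + σ_{i,j} τ_{i+1,j} ) − q ∑_{(i,j)} σ_{i,j} τ_{i,j}, the weak balance condition holds: for every σ ∈ {−1,+1}^{(ℤ/Nℤ)²}, ∑_{τ} exp(−H(σ,τ)) = ∑_{τ} exp(−H(τ,σ)). -/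
open Finset

/-- The partition function of independent spins in an external field `h`. -/
theorem sum_exp_sum_mul_spin {ι : Type*} [Fintype ι] [DecidableEq ι] (h : ι → ℝ) :
    ∑ τ : ι → ({-1, 1} : Finset ℝ), Real.exp (∑ p, h p * (τ p : ℝ)) =
      ∏ p, (Real.exp (h p) + Real.exp (-h p)) := by
  have spin_sum (p : ι) : Real.exp (h p) + Real.exp (-h p) =
      ∑ s : ({-1, 1} : Finset ℝ), Real.exp (h p * (s : ℝ)) := by
    rw [Finset.sum_coe_sort ({-1, 1} : Finset ℝ) fun s => Real.exp (h p * s),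
      Finset.sum_pair (by norm_num)]
    simp [add_comm]
  simp_rw [spin_sum, Real.exp_sum]
  rw [Finset.prod_univ_sum, Fintype.piFinset_univ]

/-- The logarithm of the one-site weight is an even function of three spins, hence a
combination of a constant and the pair products. -/
theorem exists_one_site_weight_eq_exp (J q : ℝ) : ∃ a b c : ℝ,
    ∀ x y z : ({-1, 1} : Finset ℝ),
      Real.exp (J * ((y : ℝ) + z) + q * x) + Real.exp (-(J * ((y : ℝ) + z) + q * x)) =
        Real.exp (a + b * ((y : ℝ) * z) + c * ((x : ℝ) * y + (x : ℝ) * z)) := by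
  let L : ℝ → ℝ := fun t => Real.log (Real.exp t + Real.exp (-t))
  have exp_L (t : ℝ) : Real.exp t + Real.exp (-t) = Real.exp (L t) :=
    (Real.exp_log (by positivity)).symm
  have L_neg (t : ℝ) : L (-t) = L t := by simp [L, add_comm]
  refine ⟨(L (2 * J + q) + L (2 * J - q)) / 4 + L q / 2,
    (L (2 * J + q) + L (2 * J - q)) / 4 - L q / 2, (L (2 * J + q) - L (2 * J - q)) / 4, ?_⟩
  rintro ⟨x, hx⟩ ⟨y, hy⟩ ⟨z, hz⟩
  have h₁ := L_neg (2 * J + q)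
  have h₂ := L_neg (2 * J - q)
  have h₃ := L_neg q
  rw [exp_L, Real.exp_eq_exp]
  simp only [Finset.mem_insert, Finset.mem_singleton] at hx hy hz
  rcases hx with rfl | rfl <;> rcases hy with rfl | rfl <;> rcases hz with rfl | rfl <;>
    ring_nf at h₁ h₂ h₃ ⊢ <;> linarith

/-- **Weak balance for the completely asymmetric 2D Ising PCA on the torus.**
For `H (σ,τ) = -J * ∑ (i,j), (σ (i,j) * τ (i,j+1) + σ (i,j) * τ (i+1,j))
  - q * ∑ (i,j), σ (i,j) * τ (i,j)` on spin configurations on the `N × N` torus,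
the weak balance condition `∑ τ, exp (-H (σ,τ)) = ∑ τ, exp (-H (τ,σ))` holds for
every `σ`. -/
theorem two_d_torus_weak_balance (N : ℕ) [NeZero N] (J q : ℝ)
    (H : (ZMod N × ZMod N → ({-1, 1} : Finset ℝ)) →
         (ZMod N × ZMod N → ({-1, 1} : Finset ℝ)) → ℝ)
    (hH : ∀ σ τ, H σ τ =
      -J * ∑ p : ZMod N × ZMod N,
          ((σ p : ℝ) * (τ (p.1, p.2 + 1) : ℝ) + (σ p : ℝ) * (τ (p.1 + 1, p.2) : ℝ))
        - q * ∑ p : ZMod N × ZMod N, (σ p : ℝ) * (τ p : ℝ)) :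
    ∀ σ : ZMod N × ZMod N → ({-1, 1} : Finset ℝ),
      ∑ τ : ZMod N × ZMod N → ({-1, 1} : Finset ℝ), Real.exp (-H σ τ) =
        ∑ τ : ZMod N × ZMod N → ({-1, 1} : Finset ℝ), Real.exp (-H τ σ) := by
  intro σ
  obtain ⟨a, b, c, hw⟩ := exists_one_site_weight_eq_exp J q
  have shift (v : ZMod N × ZMod N) (f : ZMod N × ZMod N → ℝ) :
      ∑ p, f (p + v) = ∑ p, f p := Equiv.sum_comp (Equiv.addRight v) f
  have hleft (τ : ZMod N × ZMod N → ({-1, 1} : Finset ℝ)) : -H σ τ =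
      ∑ p, (J * ((σ (p + (-1, 0)) : ℝ) + σ (p + (0, -1))) + q * σ p) * (τ p : ℝ) := by
    have h₁ := shift (1, 0) fun p => (σ (p + (-1, 0)) : ℝ) * τ p
    have h₂ := shift (0, 1) fun p => (σ (p + (0, -1)) : ℝ) * τ p
    simp only [add_assoc, Prod.mk_add_mk, add_neg_cancel, add_zero, Prod.mk_zero_zero] at h₁ h₂
    have h₃ : ∑ p, (J * ((σ (p + (-1, 0)) : ℝ) + σ (p + (0, -1))) + q * σ p) * (τ p : ℝ) =
        J * ∑ p, (σ (p + (-1, 0)) : ℝ) * τ p + J * ∑ p, (σ (p + (0, -1)) : ℝ) * τ p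
          + q * ∑ p, (σ p : ℝ) * τ p := by
      simp only [Finset.mul_sum, ← Finset.sum_add_distrib]
      exact Finset.sum_congr rfl fun p _ => by ring
    rw [h₃, ← h₁, ← h₂, hH, Finset.sum_add_distrib]
    simp only [Prod.add_def, add_zero]
    ring
  have hright (τ : ZMod N × ZMod N → ({-1, 1} : Finset ℝ)) : -H τ σ =
      ∑ p, (J * ((σ (p + (1, 0)) : ℝ) + σ (p + (0, 1))) + q * σ p) * (τ p : ℝ) := by
    rw [hH, neg_sub, neg_mul, sub_neg_eq_add]
    simp only [Finset.mul_sum, ← Finset.sum_add_distrib]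
    refine Finset.sum_congr rfl fun p _ => ?_
    simp only [Prod.add_def, add_zero]
    ring
  simp_rw [hleft, hright]
  rw [sum_exp_sum_mul_spin, sum_exp_sum_mul_spin]
  simp_rw [hw]
  rw [← Real.exp_sum, ← Real.exp_sum]
  have h₁ := shift (1, 0) fun p => (σ p : ℝ) * σ (p + (-1, 0))
  have h₂ := shift (0, 1) fun p => (σ p : ℝ) * σ (p + (0, -1))
  have h₃ := shift (1, 1) fun p => (σ (p + (-1, 0)) : ℝ) * σ (p + (0, -1))
  simp only [add_assoc, Prod.mk_add_mk, add_neg_cancel, add_zero, Prod.mk_zero_zero] at h₁ h₂ h₃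
  simp only [Finset.sum_add_distrib, ← Finset.mul_sum]
  rw [← h₁, ← h₂, ← h₃]
  simp only [mul_comm]
end
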